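/- arXiv:2308.06081 — 3 statements merged into one kernel-verified Lean document; each statement's English description precedes it below -/
import Mathlib

section
/- Let n ≥ 1, let A be the adjacency matrix of the hypercube Q_n, and let Ŝ be the 2ⁿ×(n+1) real matrix with Ŝ_{v,j} = 1/√C(n,j) if the Hamming weight of v equals j, and 0 otherwise. Then Ŝᵀ A Ŝ equals the (n+1)×(n+1) matrix Â with entries Â_{i,i+1} = Â_{i+1,i} = √((n−i)(i+1)) for 0 ≤ i ≤ n−1 and all other entries 0; moreover Ŝᵀ Ŝ is the (n+1)×(n+1) identity matrix. -/
open Finset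

/-- Flip the `i`-th bit of a bit-string. -/
def flipBit {n : ℕ} (v : Fin n → Fin 2) (i : Fin n) : Fin n → Fin 2 :=
  Function.update v i (1 - v i)

theorem Fin.one_sub_ne_self (a : Fin 2) : 1 - a ≠ a := by
  revert a; decide

theorem Fin.eq_one_sub_of_ne {a b : Fin 2} (h : a ≠ b) : b = 1 - a := by
  revert a b; decide

theorem flipBit_injective {n : ℕ} (v : Fin n → Fin 2) : Function.Injective (flipBit v) := by
  intro i j h
  by_contra hij
  have := congrFun h i
  simp only [flipBit, Function.update_self, Function.update_of_ne hij] at this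
  exact Fin.one_sub_ne_self _ this

theorem hammingDist_eq_one_iff {n : ℕ} (u v : Fin n → Fin 2) :
    hammingDist u v = 1 ↔ ∃ i, flipBit u i = v := by
  constructor
  · intro h
    obtain ⟨i, hi⟩ := card_eq_one.mp h
    refine ⟨i, funext fun j => ?_⟩
    have hj : u j ≠ v j ↔ j = i := by simpa using Finset.ext_iff.mp hi j
    by_cases hji : j = i
    · subst hji
      simpa [flipBit] using (Fin.eq_one_sub_of_ne (hj.mpr rfl)).symm
    · simpa [flipBit, hji] using hj
  · rintro ⟨i, rfl⟩
    refine card_eq_one.mpr ⟨i, ?_⟩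
    ext j
    rw [mem_filter]
    by_cases hji : j = i
    · subst hji
      simpa [flipBit] using (Fin.one_sub_ne_self _).symm
    · simp [flipBit, hji]

theorem sum_hammingDist_eq_one {n : ℕ} (v : Fin n → Fin 2) (g : (Fin n → Fin 2) → ℝ) :
    ∑ u, (if hammingDist v u = 1 then g u else 0) = ∑ i, g (flipBit v i) := by
  have h : univ.filter (fun u => hammingDist v u = 1) = univ.image (flipBit v) := by
    ext u; simp [hammingDist_eq_one_iff]
  rw [← sum_filter, h, sum_image fun i _ j _ hij => flipBit_injective v hij]

theorem hammingDist_zero_eq_sum {n : ℕ} (v : Fin n → Fin 2) :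
    hammingDist v (fun _ => 0) = ∑ i, (v i : ℕ) := by
  rw [hammingDist, card_filter]
  refine sum_congr rfl fun i _ => ?_
  generalize v i = a
  revert a; decide

theorem hammingDist_flipBit_add {n : ℕ} (v : Fin n → Fin 2) (i : Fin n) :
    hammingDist (flipBit v i) (fun _ => 0) + (v i : ℕ) =
      hammingDist v (fun _ => 0) + ((1 - v i : Fin 2) : ℕ) := by
  rw [hammingDist_zero_eq_sum, hammingDist_zero_eq_sum,
    ← add_sum_erase univ _ (mem_univ i), ← add_sum_erase univ (fun j => (v j : ℕ)) (mem_univ i)]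
  have : ∑ j ∈ univ.erase i, (flipBit v i j : ℕ) = ∑ j ∈ univ.erase i, (v j : ℕ) :=
    sum_congr rfl fun j hj => by simp [flipBit, ne_of_mem_erase hj]
  rw [this]
  simp only [flipBit, Function.update_self]
  ring

theorem sum_flipBit_weight {n : ℕ} (v : Fin n → Fin 2) (k : ℕ) (c : ℝ) :
    ∑ i, (if hammingDist (flipBit v i) (fun _ => 0) = k then c else 0) =
      (if k = hammingDist v (fun _ => 0) + 1 then
        ((n : ℝ) - (hammingDist v (fun _ => 0) : ℕ)) * c
      else if hammingDist v (fun _ => 0) = k + 1 then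
        (hammingDist v (fun _ => 0) : ℕ) * c else 0) := by
  have hw := hammingDist_zero_eq_sum v
  have hflip := hammingDist_flipBit_add v
  generalize hammingDist v (fun _ => 0) = w at *
  have hwR : (w : ℝ) = ∑ i, ((v i : ℕ) : ℝ) := by rw [hw]; push_cast; rfl
  have hbit (i : Fin n) : v i = 0 ∨ v i = 1 := by
    generalize v i = a
    revert a; decide
  have hterm (i : Fin n) : (if hammingDist (flipBit v i) (fun _ => 0) = k then c else 0) =
      (if k = w + 1 then (1 - ((v i : ℕ) : ℝ)) * c
        else if w = k + 1 then ((v i : ℕ) : ℝ) * c else 0) := by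
    have hi := hflip i
    rcases hbit i with h | h <;> simp [h] at hi ⊢ <;> split_ifs <;> first | rfl | omega
  rw [sum_congr rfl fun i _ => hterm i]
  split_ifs
  · rw [← sum_mul, sum_sub_distrib, hwR]; simp
  · rw [← sum_mul, hwR]
  · simp

theorem card_hammingDist_zero_eq (n k : ℕ) :
    (univ.filter fun v : Fin n → Fin 2 => hammingDist v (fun _ => 0) = k).card =
      n.choose k := by
  have h : (powersetCard k (univ : Finset (Fin n))).card = n.choose k := by simp
  rw [← h]
  refine card_bij' (fun v _ => univ.filter fun i => v i ≠ 0)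
    (fun s _ i => if i ∈ s then 1 else 0) ?_ ?_ ?_ ?_
  · intro v hv
    simpa [hammingDist, mem_powersetCard] using hv
  · intro s hs
    simpa [hammingDist, mem_powersetCard] using hs
  · intro v _
    funext i
    simp only [mem_filter, mem_univ, true_and]
    generalize v i = a
    revert a; decide
  · intro s _
    ext i
    simp

theorem sum_weight_eq_const (n k : ℕ) (c : ℝ) :
    ∑ v : Fin n → Fin 2, (if hammingDist v (fun _ => 0) = k then c else 0) =
      n.choose k * c := by
  rw [← sum_filter, sum_const, card_hammingDist_zero_eq, nsmul_eq_mul]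

theorem cast_choose_succ_mul {n i : ℕ} (hi : i < n) :
    (n.choose (i + 1) : ℝ) * (i + 1) = n.choose i * ((n : ℝ) - i) := by
  rw [← Nat.cast_sub hi.le]
  exact_mod_cast Nat.choose_succ_right_eq n i

theorem sqrt_choose_succ {n i : ℕ} (hi : i < n) :
    Real.sqrt (n.choose i) * Real.sqrt (((n : ℝ) - i) * (i + 1)) =
      Real.sqrt (n.choose (i + 1)) * (i + 1) := by
  have h := cast_choose_succ_mul hi
  have hs : ((i : ℝ) + 1) = Real.sqrt (((i : ℝ) + 1) * (i + 1)) :=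
    (Real.sqrt_mul_self (by positivity)).symm
  conv_rhs => rw [hs]
  rw [← Real.sqrt_mul (by positivity), ← Real.sqrt_mul (by positivity), ← mul_assoc,
    ← mul_assoc, h]

theorem sqrt_choose_succ' {n i : ℕ} (hi : i < n) :
    Real.sqrt (n.choose (i + 1)) * Real.sqrt (((n : ℝ) - i) * (i + 1)) =
      Real.sqrt (n.choose i) * ((n : ℝ) - i) := by
  have h := cast_choose_succ_mul hi
  have hni : (0 : ℝ) ≤ (n : ℝ) - i := sub_nonneg.mpr (by exact_mod_cast hi.le)
  have hs : ((n : ℝ) - i) = Real.sqrt (((n : ℝ) - i) * ((n : ℝ) - i)) :=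
    (Real.sqrt_mul_self hni).symm
  conv_rhs => rw [hs]
  rw [← Real.sqrt_mul (by positivity), ← Real.sqrt_mul (by positivity), mul_comm ((n : ℝ) - i),
    ← mul_assoc, ← mul_assoc, h]

/-- With `Ŝ` the normalized indicator matrix of the Hamming-weight partition of the
hypercube `Q_n`, one has `Ŝᵀ A Ŝ = Â` (the weighted-path adjacency matrix of the
symmetrized quotient) and `Ŝᵀ Ŝ = I`. -/
theorem stmt_6 (n : ℕ) (hn : 1 ≤ n)
    (A : Matrix (Fin n → Fin 2) (Fin n → Fin 2) ℝ)
    (hA : ∀ u v, A u v = if hammingDist u v = 1 then 1 else 0)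
    (S : Matrix (Fin n → Fin 2) (Fin (n + 1)) ℝ)
    (hS : ∀ (v : Fin n → Fin 2) (j : Fin (n + 1)), S v j =
      if hammingDist v (fun _ => 0) = (j : ℕ) then 1 / Real.sqrt (n.choose (j : ℕ)) else 0)
    (Ahat : Matrix (Fin (n + 1)) (Fin (n + 1)) ℝ)
    (hAhat : ∀ i j : Fin (n + 1), Ahat i j =
      if (j : ℕ) = (i : ℕ) + 1 then Real.sqrt (((n : ℝ) - (i : ℕ)) * ((i : ℕ) + 1))
      else if (i : ℕ) = (j : ℕ) + 1 then Real.sqrt (((n : ℝ) - (j : ℕ)) * ((j : ℕ) + 1))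
      else 0) :
    S.transpose * A * S = Ahat ∧ S.transpose * S = 1 := by
  have hpos (j : Fin (n + 1)) : 0 < Real.sqrt (n.choose (j : ℕ)) :=
    Real.sqrt_pos.mpr (by exact_mod_cast Nat.choose_pos (Nat.lt_succ_iff.mp j.2))
  have hcancel (j : Fin (n + 1)) (x : ℝ) :
      (n.choose (j : ℕ) : ℝ) * (1 / Real.sqrt (n.choose (j : ℕ)) * x) =
        Real.sqrt (n.choose (j : ℕ)) * x := by
    rw [← mul_assoc, mul_one_div, Real.div_sqrt]
  constructor
  · ext i j
    have hAS (v : Fin n → Fin 2) : (A * S) v j =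
        (if (j : ℕ) = hammingDist v (fun _ => 0) + 1 then
          ((n : ℝ) - (hammingDist v (fun _ => 0) : ℕ)) * (1 / Real.sqrt (n.choose (j : ℕ)))
        else if hammingDist v (fun _ => 0) = (j : ℕ) + 1 then
          (hammingDist v (fun _ => 0) : ℕ) * (1 / Real.sqrt (n.choose (j : ℕ))) else 0) := by
      rw [← sum_flipBit_weight, ← sum_hammingDist_eq_one v
        (fun u => if hammingDist u (fun _ => 0) = (j : ℕ) then
          1 / Real.sqrt (n.choose (j : ℕ)) else 0), Matrix.mul_apply]
      simp only [hA, hS, ite_mul, one_mul, zero_mul]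
    have hsum : (S.transpose * A * S) i j = ∑ v : Fin n → Fin 2,
        (if hammingDist v (fun _ => 0) = (i : ℕ) then 1 / Real.sqrt (n.choose (i : ℕ)) *
          (if (j : ℕ) = (i : ℕ) + 1 then
            ((n : ℝ) - (i : ℕ)) * (1 / Real.sqrt (n.choose (j : ℕ)))
          else if (i : ℕ) = (j : ℕ) + 1 then
            (i : ℕ) * (1 / Real.sqrt (n.choose (j : ℕ))) else 0) else 0) := by
      rw [Matrix.mul_assoc, Matrix.mul_apply]
      refine sum_congr rfl fun v _ => ?_
      rw [hAS, Matrix.transpose_apply, hS]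
      by_cases h : hammingDist v (fun _ => 0) = (i : ℕ)
      · simp only [h, if_true]
      · simp only [h, if_false, zero_mul]
    rw [hsum, sum_weight_eq_const, hcancel, hAhat]
    have hj := hpos j
    split_ifs with h₁ h₂
    · have := sqrt_choose_succ' (n := n) (i := i) (by omega)
      rw [h₁] at hj ⊢
      rw [← mul_assoc, ← this, mul_one_div, mul_div_cancel_left₀ _ hj.ne']
    · have := sqrt_choose_succ (n := n) (i := j) (by omega)
      rw [h₂]
      push_cast
      rw [← mul_assoc, ← this, mul_one_div, mul_div_cancel_left₀ _ hj.ne']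
    · simp
  · ext i j
    rw [Matrix.mul_apply, Matrix.one_apply]
    simp only [Matrix.transpose_apply, hS]
    by_cases hij : i = j
    · subst hij
      have hi := hpos i
      simp only [ite_mul, zero_mul, if_true]
      rw [sum_congr rfl (g := fun v : Fin n → Fin 2 => if hammingDist v (fun _ => 0) = (i : ℕ) then
        1 / Real.sqrt (n.choose (i : ℕ)) * (1 / Real.sqrt (n.choose (i : ℕ))) else 0)
        fun v _ => by split_ifs <;> rfl, sum_weight_eq_const, hcancel]
      field_simp
    · rw [if_neg hij]
      refine sum_eq_zero fun v _ => ?_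
      have hij' : (i : ℕ) ≠ j := fun h => hij (Fin.ext h)
      split_ifs <;> first | omega | simp
end

section
/- Let H be a complex inner product space, let f₀, f₁ ∈ H be orthonormal vectors, let θ ∈ ℝ, and set ψ = cos θ · f₀ + sin θ · f₁. Define the reflections S_χ = id − 2⟨f₁, ·⟩f₁ and R_ψ = 2⟨ψ, ·⟩ψ − id, and the Grover iterate Q = R_ψ ∘ S_χ. Then for every natural number m, Q^m ψ = cos((2m+1)θ) · f₀ + sin((2m+1)θ) · f₁; i.e. each application of Q rotates the state by an additional angle 2θ in the two-dimensional invariant subspace spanned by f₀ and f₁. -/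
local notation "⟪" x ", " y "⟫" => @inner ℂ _ _ x y

section Reflections

variable {H : Type*} [NormedAddCommGroup H] [InnerProductSpace ℂ H] {f₀ f₁ : H}

/-- The point at angle `a` on the real unit circle spanned by `f₀` and `f₁`. -/
noncomputable def circlePoint (f₀ f₁ : H) (a : ℝ) : H :=
  (Real.cos a : ℂ) • f₀ + (Real.sin a : ℂ) • f₁

theorem inner_right_circlePoint (h11 : ⟪f₁, f₁⟫ = 1) (h01 : ⟪f₀, f₁⟫ = 0) (a : ℝ) :
    ⟪f₁, circlePoint f₀ f₁ a⟫ = (Real.sin a : ℂ) := by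
  have h10 : ⟪f₁, f₀⟫ = 0 := inner_eq_zero_symm.mp h01
  simp only [circlePoint, inner_add_right, inner_smul_right, h10, h11]
  ring

theorem inner_circlePoint (h00 : ⟪f₀, f₀⟫ = 1) (h11 : ⟪f₁, f₁⟫ = 1) (h01 : ⟪f₀, f₁⟫ = 0)
    (a b : ℝ) :
    ⟪circlePoint f₀ f₁ a, circlePoint f₀ f₁ b⟫ = (Real.cos (a - b) : ℂ) := by
  have h10 : ⟪f₁, f₀⟫ = 0 := inner_eq_zero_symm.mp h01
  simp only [circlePoint, inner_add_right, inner_add_left, inner_smul_right, inner_smul_left,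
    h00, h01, h10, h11, Complex.conj_ofReal, Real.cos_sub]
  push_cast
  ring

/-- The reflection about the orthogonal complement of `f₁` negates the angle. -/
theorem circlePoint_sub_two_mul_inner_smul (h11 : ⟪f₁, f₁⟫ = 1) (h01 : ⟪f₀, f₁⟫ = 0) (a : ℝ) :
    circlePoint f₀ f₁ a - (2 * ⟪f₁, circlePoint f₀ f₁ a⟫) • f₁ = circlePoint f₀ f₁ (-a) := by
  rw [inner_right_circlePoint h11 h01]
  simp only [circlePoint, Real.cos_neg, Real.sin_neg, Complex.ofReal_neg]
  module

/-- The reflection about the point at angle `a` maps the angle `b` to `2 * a - b`. -/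
theorem two_mul_inner_smul_circlePoint_sub (h00 : ⟪f₀, f₀⟫ = 1) (h11 : ⟪f₁, f₁⟫ = 1)
    (h01 : ⟪f₀, f₁⟫ = 0) (a b : ℝ) :
    (2 * ⟪circlePoint f₀ f₁ a, circlePoint f₀ f₁ b⟫) • circlePoint f₀ f₁ a -
      circlePoint f₀ f₁ b = circlePoint f₀ f₁ (2 * a - b) := by
  have hc : Real.cos (2 * a - b) = 2 * Real.cos (a - b) * Real.cos a - Real.cos b := by
    rw [show 2 * a - b = (a - b) + a by ring, Real.cos_add]
    nth_rewrite 4 [show b = a - (a - b) by ring]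
    rw [Real.cos_sub a (a - b)]
    ring
  have hs : Real.sin (2 * a - b) = 2 * Real.cos (a - b) * Real.sin a - Real.sin b := by
    rw [show 2 * a - b = (a - b) + a by ring, Real.sin_add]
    nth_rewrite 4 [show b = a - (a - b) by ring]
    rw [Real.sin_sub a (a - b)]
    ring
  rw [inner_circlePoint h00 h11 h01]
  simp only [circlePoint, hc, hs]
  push_cast
  module

end Reflections

/-- Amplitude amplification: with `ψ = cos θ f₀ + sin θ f₁` for orthonormal `f₀, f₁`,
the Grover iterate `Q = R_ψ ∘ S_χ` satisfies
`Qᵐ ψ = cos ((2m+1)θ) f₀ + sin ((2m+1)θ) f₁` for every `m`. -/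
theorem stmt_16 {H : Type*} [NormedAddCommGroup H] [InnerProductSpace ℂ H]
    (f₀ f₁ : H) (h00 : ⟪f₀, f₀⟫ = 1) (h11 : ⟪f₁, f₁⟫ = 1) (h01 : ⟪f₀, f₁⟫ = 0)
    (θ : ℝ) (ψ : H) (hψ : ψ = (Real.cos θ : ℂ) • f₀ + (Real.sin θ : ℂ) • f₁)
    (Sχ Rψ Q : H → H)
    (hS : ∀ x, Sχ x = x - (2 * ⟪f₁, x⟫) • f₁)
    (hR : ∀ x, Rψ x = (2 * ⟪ψ, x⟫) • ψ - x)
    (hQ : Q = Rψ ∘ Sχ) :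
    ∀ m : ℕ, Q^[m] ψ =
      (Real.cos ((2 * (m : ℝ) + 1) * θ) : ℂ) • f₀ +
        (Real.sin ((2 * (m : ℝ) + 1) * θ) : ℂ) • f₁ := by
  change ψ = circlePoint f₀ f₁ θ at hψ
  intro m
  change Q^[m] ψ = circlePoint f₀ f₁ ((2 * (m : ℝ) + 1) * θ)
  induction m with
  | zero => simp [hψ]
  | succ k ih =>
    rw [Function.iterate_succ_apply', ih, hQ, Function.comp_apply, hS,
      circlePoint_sub_two_mul_inner_smul h11 h01, hR, hψ,
      two_mul_inner_smul_circlePoint_sub h00 h11 h01]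
    congr 1
    push_cast
    ring
end

section
/- Let A ≤ κ ≤ B be reals, ε ≥ 0, and let p, p_exact : ℝ → ℝ be integrable on [A, B] with p(x) ≤ p_exact(x) + ε for all x ∈ [A, B] and p, p_exact ≥ 0 on [A, B]. Then ∫_A^B (x − κ)² p(x) dx ≤ ∫_A^B (x − κ)² p_exact(x) dx + (ε/3)(B − A)³. In particular, if κ̂ is an estimator whose distribution under approximate gate synthesis has density p and whose distribution under exact execution has density p_exact, both supported on the range [A, B] of the applied function, then MSE(κ̂) ≤ MSE_exact(κ̂) + (ε_tot/3)(B − A)³. -/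
open MeasureTheory

theorem integral_sub_sq (A B κ : ℝ) :
    ∫ x in A..B, (x - κ) ^ 2 = ((B - κ) ^ 3 + (κ - A) ^ 3) / 3 := by
  rw [intervalIntegral.integral_comp_sub_right (fun x => x ^ 2), integral_pow]
  norm_num
  ring

theorem sub_pow_three_add_le {A B κ : ℝ} (hAκ : A ≤ κ) (hκB : κ ≤ B) :
    (B - κ) ^ 3 + (κ - A) ^ 3 ≤ (B - A) ^ 3 := by
  have h : 0 ≤ (B - κ) * (κ - A) * (B - A) :=
    mul_nonneg (mul_nonneg (sub_nonneg.2 hκB) (sub_nonneg.2 hAκ))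
      (sub_nonneg.2 (hAκ.trans hκB))
  linear_combination 3 * h

/-- If the density `p` under approximate gate synthesis exceeds the exact density
`p_exact` by at most `ε` pointwise on `[A, B]`, then the mean-squared error about any
`κ ∈ [A, B]` increases by at most `(ε/3)(B - A)³`. -/
theorem stmt_17 (A B κ ε : ℝ) (hAκ : A ≤ κ) (hκB : κ ≤ B) (hε : 0 ≤ ε)
    (p pexact : ℝ → ℝ)
    (hip : IntervalIntegrable p volume A B)
    (hie : IntervalIntegrable pexact volume A B)
    (hle : ∀ x ∈ Set.Icc A B, p x ≤ pexact x + ε)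
    (hp0 : ∀ x ∈ Set.Icc A B, 0 ≤ p x)
    (hpe0 : ∀ x ∈ Set.Icc A B, 0 ≤ pexact x) :
    ∫ x in A..B, (x - κ) ^ 2 * p x ≤
      (∫ x in A..B, (x - κ) ^ 2 * pexact x) + ε / 3 * (B - A) ^ 3 := by
  have hAB : A ≤ B := hAκ.trans hκB
  have hc : ContinuousOn (fun x : ℝ => (x - κ) ^ 2) (Set.uIcc A B) := by fun_prop
  have hiq := hie.continuousOn_mul hc
  have hiε : IntervalIntegrable (fun x : ℝ => ε * (x - κ) ^ 2) volume A B :=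
    hc.intervalIntegrable.const_mul ε
  calc ∫ x in A..B, (x - κ) ^ 2 * p x
      ≤ ∫ x in A..B, ((x - κ) ^ 2 * pexact x + ε * (x - κ) ^ 2) := by
        refine intervalIntegral.integral_mono_on hAB (hip.continuousOn_mul hc)
          (hiq.add hiε) fun x hx => ?_
        nlinarith [mul_le_mul_of_nonneg_left (hle x hx) (sq_nonneg (x - κ))]
    _ = (∫ x in A..B, (x - κ) ^ 2 * pexact x) + ε * (((B - κ) ^ 3 + (κ - A) ^ 3) / 3) := by
        rw [intervalIntegral.integral_add hiq hiε, intervalIntegral.integral_const_mul,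
          integral_sub_sq]
    _ ≤ (∫ x in A..B, (x - κ) ^ 2 * pexact x) + ε / 3 * (B - A) ^ 3 := by
        linear_combination ε / 3 * sub_pow_three_add_le hAκ hκB
end
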